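/- Let c₁, c₂ ≥ 0 be real numbers, P > 0, and t ∈ [0, √P] be real. If P c₁² < t² (c₁² + c₂²), then for every real a with t ≤ a ≤ √P one has a c₁ + √(P − a²) c₂ ≤ t c₁ + √(P − t²) c₂. -/

import Mathlib

/-- Real-variable lemma behind the second branch of Theorem 1: if `c₁, c₂ ≥ 0`, `P > 0`,
`t ∈ [0, √P]` and `P c₁² < t² (c₁² + c₂²)`, then on `[t, √P]` the function
`a ↦ a c₁ + √(P − a²) c₂` is maximized at the lower endpoint `a = t`. -/
theorem endpoint_max (c1 c2 P t : ℝ) (hc1 : 0 ≤ c1) (hc2 : 0 ≤ c2) (hP : 0 < P)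
    (ht0 : 0 ≤ t) (htP : t ≤ Real.sqrt P)
    (hweak : P * c1 ^ 2 < t ^ 2 * (c1 ^ 2 + c2 ^ 2)) :
    ∀ a : ℝ, t ≤ a → a ≤ Real.sqrt P →
      a * c1 + Real.sqrt (P - a ^ 2) * c2 ≤ t * c1 + Real.sqrt (P - t ^ 2) * c2 := by
  intro a hta haP
  have hsq : Real.sqrt P ^ 2 = P := Real.sq_sqrt hP.le
  have haP2 : a ^ 2 ≤ P := by
    rw [← hsq]; exact pow_le_pow_left₀ (ht0.trans hta) haP 2
  have hta2 : t ^ 2 ≤ a ^ 2 := pow_le_pow_left₀ ht0 hta 2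
  have hs2 : Real.sqrt (P - t ^ 2) ^ 2 = P - t ^ 2 := Real.sq_sqrt (by linarith)
  have hb2 : Real.sqrt (P - a ^ 2) ^ 2 = P - a ^ 2 := Real.sq_sqrt (by linarith)
  have hbs : Real.sqrt (P - a ^ 2) ≤ Real.sqrt (P - t ^ 2) :=
    Real.sqrt_le_sqrt (by linarith)
  have hs0 := Real.sqrt_nonneg (P - t ^ 2)
  generalize Real.sqrt (P - t ^ 2) = s at *
  generalize Real.sqrt (P - a ^ 2) = b at *
  have htpos : 0 < t := by
    rcases ht0.eq_or_lt with h | h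
    · subst h
      have : 0 ≤ P * c1 ^ 2 := by positivity
      nlinarith
    · exact h
  have h1 : s * c1 ≤ t * c2 := by
    refine abs_le_of_sq_le_sq' ?_ (by positivity) |>.2
    rw [mul_pow, mul_pow, hs2]
    linarith
  have h2 : (s + b) * c1 ≤ (a + t) * c2 := by
    have e1 : b * c1 ≤ s * c1 := mul_le_mul_of_nonneg_right hbs hc1
    have e2 : t * c2 ≤ a * c2 := mul_le_mul_of_nonneg_right hta hc2
    linarith
  have h3 : (s - b) * ((s + b) * c1) ≤ (s - b) * ((a + t) * c2) :=
    mul_le_mul_of_nonneg_left h2 (by linarith)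
  have h4 : (a + t) * ((a - t) * c1) ≤ (a + t) * ((s - b) * c2) := by
    have e : (s - b) * (s + b) = (a + t) * (a - t) := by linarith
    calc (a + t) * ((a - t) * c1) = (s - b) * (s + b) * c1 := by rw [e]; ring
      _ ≤ (a + t) * ((s - b) * c2) := by linarith
  have h5 := le_of_mul_le_mul_left h4 (by linarith)
  linarith
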